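/- arXiv:2305.04263 — 2 statements merged into one kernel-verified Lean document; each statement's English description precedes it below -/
import Mathlib

section
/- (Generalized (p,q)-super Virasoro algebra with conformal dimension Δ = 1: rescaled relation.) Let p, q > 0 be reals with p ≠ q, and let n, m be integers with n ≠ m. Define rescaled generators L_n = q^{−N₁} ∘ 𝓛¹_n, i.e. L_n(z^k) = q^{−(k+n+1)} [k+1]_{p,q} z^{k+n}. Put u = q^{m−n}·([n−m]_{p,q}/[m−n]_{p,q}) and v = p^{m−n}·([n−m]_{p,q}/[m−n]_{p,q}). Then u·L_n∘L_m − v·L_m∘L_n = [n−m]_{p,q} · L_{n+m}; explicitly, for every k ∈ ℤ: u·q^{−(k+m+1)}[k+1]_{p,q}·q^{−(k+m+n+1)}[k+m+1]_{p,q} − v·q^{−(k+n+1)}[k+1]_{p,q}·q^{−(k+m+n+1)}[k+n+1]_{p,q} = [n−m]_{p,q}·q^{−(k+n+m+1)}[k+1]_{p,q}. -/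
/-- The `(p,q)`-deformed number `[x]_{p,q} = (p^x - q^x)/(p - q)` (real powers). -/
noncomputable def pqNum (p q x : ℝ) : ℝ := (p ^ x - q ^ x) / (p - q)

theorem pqNum_ne_zero {p q : ℝ} (hp : 0 < p) (hq : 0 < q) (hpq : p ≠ q) {x : ℝ} (hx : x ≠ 0) :
    pqNum p q x ≠ 0 :=
  div_ne_zero (sub_ne_zero.mpr fun h => hpq ((Real.rpow_left_inj hp.le hq.le hx).mp h))
    (sub_ne_zero.mpr hpq)

/-- The deformed subtraction formula behind the rescaled commutation relation. -/
theorem pqNum_sub {p q : ℝ} (hp : 0 < p) (hq : 0 < q) (x y : ℝ) :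
    q ^ (x - y) * (q ^ (-x) * pqNum p q x) - p ^ (x - y) * (q ^ (-y) * pqNum p q y) =
      pqNum p q (x - y) := by
  have hqx := (Real.rpow_pos_of_pos hq x).ne'
  have hqy := (Real.rpow_pos_of_pos hq y).ne'
  have hpy := (Real.rpow_pos_of_pos hp y).ne'
  simp only [pqNum, Real.rpow_sub hp, Real.rpow_sub hq, Real.rpow_neg hq.le]
  field_simp
  ring

/-- Generalized (p,q)-super Virasoro algebra with conformal dimension Δ = 1:
rescaled relation (coefficient identity for `L_n = q^{-N₁} ∘ 𝓛¹_n` on `z^k`). -/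
theorem pq_super_virasoro_dim_one_rescaled
    (p q : ℝ) (hp : 0 < p) (hq : 0 < q) (hpq : p ≠ q)
    (n m : ℤ) (hnm : n ≠ m)
    (u v : ℝ)
    (hu : u = q ^ ((m : ℝ) - (n : ℝ)) *
        (pqNum p q ((n : ℝ) - (m : ℝ)) / pqNum p q ((m : ℝ) - (n : ℝ))))
    (hv : v = p ^ ((m : ℝ) - (n : ℝ)) *
        (pqNum p q ((n : ℝ) - (m : ℝ)) / pqNum p q ((m : ℝ) - (n : ℝ)))) :
    ∀ k : ℤ,
      u * (q ^ (-((k : ℝ) + (m : ℝ) + 1)) * pqNum p q ((k : ℝ) + 1)) *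
          (q ^ (-((k : ℝ) + (m : ℝ) + (n : ℝ) + 1)) * pqNum p q ((k : ℝ) + (m : ℝ) + 1))
        - v * (q ^ (-((k : ℝ) + (n : ℝ) + 1)) * pqNum p q ((k : ℝ) + 1)) *
          (q ^ (-((k : ℝ) + (m : ℝ) + (n : ℝ) + 1)) * pqNum p q ((k : ℝ) + (n : ℝ) + 1))
      = pqNum p q ((n : ℝ) - (m : ℝ)) *
          (q ^ (-((k : ℝ) + (n : ℝ) + (m : ℝ) + 1)) * pqNum p q ((k : ℝ) + 1)) := by
  intro k
  have hne : pqNum p q ((m : ℝ) - n) ≠ 0 :=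
    pqNum_ne_zero hp hq hpq (sub_ne_zero.mpr (Int.cast_injective.ne hnm.symm))
  have hsub := pqNum_sub hp hq ((k : ℝ) + m + 1) ((k : ℝ) + n + 1)
  rw [show (k : ℝ) + m + 1 - (k + n + 1) = m - n by ring] at hsub
  rw [hu, hv, add_right_comm (k : ℝ) n m]
  field_simp
  linear_combination (pqNum p q ((n : ℝ) - m) * pqNum p q ((k : ℝ) + 1)) * hsub
end

section
/- (Super product relation for ℛ(p,q)-conformal super operators, Δ ≠ 0,1.) Let τ₁, τ₂ > 0 be reals with τ₁ ≠ τ₂, let a, b be nonzero reals with a + b ≠ 0, let Δ ∈ ℝ and m, n ∈ ℤ. Then [Δ(n+1)]_b · [Δ(m+1)+n+1]_a = ((τ₁^{a+b} − τ₂^{a+b}) · τ₁^{a(n(1−Δ)+1)}) / ((τ₁^a − τ₂^a)(τ₁^b − τ₂^b) · τ₁^{bΔm}) · [Δ(m+n+1)]_{a+b} + τ₂^{(a+b)Δ(m+n+1)} · [n(1−Δ)+1]_a · [−Δm]_b − (τ₂^{bΔ(n+1)} / (τ₁^{a(n(Δ−1)−1)}(τ₁^b − τ₂^b))) · [Δ(m+n+1)]_a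 − (τ₂^{a(Δ(m+1)+n+1)} / (τ₁^{bΔm}(τ₁^a − τ₂^a))) · [Δ(m+n+1)]_b. (This is the coefficient identity for the product 𝒯^{aΔ}_m ∘ 𝕋^{bΔ}_n applied to 1, where 𝕋^{bΔ}_n = θ·𝒯^{bΔ}_n is the odd super operator and the action of 𝒯^{aΔ}_m on an odd monomial θx^j carries coefficient [Δ(m+1)+j+1]_a.) -/
/-- The ℛ(p,q)-deformed number in τ-form:
`[x]_c = (τ₁^{cx} - τ₂^{cx})/(τ₁^c - τ₂^c)` (real powers of positive bases). -/
noncomputable def tauNum (t1 t2 c x : ℝ) : ℝ :=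
  (t1 ^ (c * x) - t2 ^ (c * x)) / (t1 ^ c - t2 ^ c)

theorem Real.rpow_sub_rpow_ne_zero {x y c : ℝ} (hx : 0 ≤ x) (hy : 0 ≤ y) (hxy : x ≠ y)
    (hc : c ≠ 0) : x ^ c - y ^ c ≠ 0 :=
  sub_ne_zero.2 fun h => hxy ((Real.rpow_left_inj hx hy hc).1 h)

/-- Super product relation for ℛ(p,q)-conformal super operators, coefficient identity. -/
theorem rpq_conformal_super_operator_product
    (t1 t2 : ℝ) (h1 : 0 < t1) (h2 : 0 < t2) (h12 : t1 ≠ t2)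
    (a b : ℝ) (ha : a ≠ 0) (hb : b ≠ 0) (hab : a + b ≠ 0)
    (Δ : ℝ) (m n : ℤ) :
    tauNum t1 t2 b (Δ * ((n : ℝ) + 1)) * tauNum t1 t2 a (Δ * ((m : ℝ) + 1) + (n : ℝ) + 1)
      = (t1 ^ (a + b) - t2 ^ (a + b)) * t1 ^ (a * ((n : ℝ) * (1 - Δ) + 1)) /
          ((t1 ^ a - t2 ^ a) * (t1 ^ b - t2 ^ b) * t1 ^ (b * Δ * (m : ℝ))) *
          tauNum t1 t2 (a + b) (Δ * ((m : ℝ) + (n : ℝ) + 1))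
        + t2 ^ ((a + b) * Δ * ((m : ℝ) + (n : ℝ) + 1)) *
          tauNum t1 t2 a ((n : ℝ) * (1 - Δ) + 1) * tauNum t1 t2 b (-(Δ * (m : ℝ)))
        - t2 ^ (b * Δ * ((n : ℝ) + 1)) /
            (t1 ^ (a * ((n : ℝ) * (Δ - 1) - 1)) * (t1 ^ b - t2 ^ b)) *
          tauNum t1 t2 a (Δ * ((m : ℝ) + (n : ℝ) + 1))
        - t2 ^ (a * (Δ * ((m : ℝ) + 1) + (n : ℝ) + 1)) /
            (t1 ^ (b * Δ * (m : ℝ)) * (t1 ^ a - t2 ^ a)) *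
          tauNum t1 t2 b (Δ * ((m : ℝ) + (n : ℝ) + 1)) := by
  have hA := Real.rpow_sub_rpow_ne_zero h1.le h2.le h12 ha
  have hB := Real.rpow_sub_rpow_ne_zero h1.le h2.le h12 hb
  have hAB := Real.rpow_sub_rpow_ne_zero h1.le h2.le h12 hab
  unfold tauNum
  obtain ⟨S, hS⟩ : ∃ S, S = Δ * ((m : ℝ) + n + 1) := ⟨_, rfl⟩
  obtain ⟨P, hP⟩ : ∃ P, P = (n : ℝ) * (1 - Δ) + 1 := ⟨_, rfl⟩
  obtain ⟨Q, hQ⟩ : ∃ Q, Q = -(Δ * (m : ℝ)) := ⟨_, rfl⟩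
  rw [show b * (Δ * ((n : ℝ) + 1)) = b * S + b * Q by rw [hS, hQ]; ring,
    show b * Δ * ((n : ℝ) + 1) = b * S + b * Q by rw [hS, hQ]; ring,
    show a * (Δ * ((m : ℝ) + 1) + n + 1) = a * S + a * P by rw [hS, hP]; ring,
    show a * ((n : ℝ) * (Δ - 1) - 1) = -(a * P) by rw [hP]; ring,
    show b * Δ * (m : ℝ) = -(b * Q) by rw [hQ]; ring,
    show (a + b) * Δ * ((m : ℝ) + n + 1) = a * S + b * S by rw [hS]; ring,
    ← hS, ← hP, ← hQ, add_mul]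
  generalize t1 ^ (a + b) - t2 ^ (a + b) = D at hAB ⊢
  simp only [Real.rpow_neg h1.le, Real.rpow_add h1, Real.rpow_add h2]
  have hα := (Real.rpow_pos_of_pos h1 (a * P)).ne'
  have hβ := (Real.rpow_pos_of_pos h1 (b * Q)).ne'
  field_simp
  ring
end
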